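/- arXiv:1911.04531 — 5 statements merged into one kernel-verified Lean document; each statement's English description precedes it below -/
import Mathlib

section
/- Let R be a complete Noetherian local ring with maximal ideal m and let J be a homogeneous ideal of the polynomial ring R[x_1,…,x_n] (graded with deg x_i = 1 and R in degree 0). Then J·R[[x_1,…,x_n]] ∩ R[x_1,…,x_n] = J, where R[[x_1,…,x_n]] is the formal power series ring over R, which is the (m + (x_1,…,x_n))-adic completion of R[x_1,…,x_n]. -/
open IsLocalRing

/-- An element of the extension of an ideal `J` of polynomials to the ring of formal power series
agrees with some element of `J` in all total degrees below any given bound. -/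
theorem MvPolynomial.exists_mem_coeff_eq_of_mem_map {σ R : Type*} [Finite σ] [CommRing R]
    {J : Ideal (MvPolynomial σ R)} {f : MvPowerSeries σ R}
    (hf : f ∈ J.map (MvPolynomial.coeToMvPowerSeries.ringHom :
      MvPolynomial σ R →+* MvPowerSeries σ R)) (N : ℕ) :
    ∃ q ∈ J, ∀ d : σ →₀ ℕ, d.degree < N → MvPowerSeries.coeff d f = q.coeff d := by
  classical
  induction hf using Submodule.span_induction with
  | mem x hx =>
    obtain ⟨q, hq, rfl⟩ := hx
    exact ⟨q, hq, fun d _ => by simp⟩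
  | zero => exact ⟨0, J.zero_mem, fun d _ => by simp⟩
  | add x y _ _ hx hy =>
    obtain ⟨p, hp, hpx⟩ := hx
    obtain ⟨q, hq, hqy⟩ := hy
    exact ⟨p + q, J.add_mem hp hq, fun d hd => by simp [hpx d hd, hqy d hd]⟩
  | smul a x _ hx =>
    obtain ⟨q, hq, hqx⟩ := hx
    refine ⟨MvPowerSeries.truncTotal N a * q, J.mul_mem_left _ hq, fun d hd => ?_⟩
    rw [smul_eq_mul, MvPowerSeries.coeff_mul, MvPolynomial.coeff_mul]
    refine Finset.sum_congr rfl fun e he => ?_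
    have hdeg : e.1.degree + e.2.degree = d.degree := by
      rw [← map_add, Finset.HasAntidiagonal.mem_antidiagonal.mp he]
    rw [hqx e.2 (by lia), MvPowerSeries.coeff_truncTotal _ (by lia)]

/-- Let `R` be a complete Noetherian local ring and `J` a homogeneous ideal of the polynomial
ring `R[x_1, …, x_n]`.  Then `J · R[[x_1, …, x_n]] ∩ R[x_1, …, x_n] = J`, the contraction being
taken along the canonical embedding of the polynomial ring into the formal power series ring. -/
theorem epsilon_mult_stmt3
    {R : Type*} [CommRing R] [IsLocalRing R] [IsNoetherianRing R]
    [IsAdicComplete (maximalIdeal R) R] (n : ℕ)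
    (J : Ideal (MvPolynomial (Fin n) R))
    (hJ : ∀ p ∈ J, ∀ k : ℕ, MvPolynomial.homogeneousComponent k p ∈ J) :
    Ideal.comap
        (MvPolynomial.coeToMvPowerSeries.ringHom :
          MvPolynomial (Fin n) R →+* MvPowerSeries (Fin n) R)
        (Ideal.map
          (MvPolynomial.coeToMvPowerSeries.ringHom :
            MvPolynomial (Fin n) R →+* MvPowerSeries (Fin n) R) J) = J := by
  refine le_antisymm (fun p hp => ?_) Ideal.le_comap_map
  rw [← MvPolynomial.sum_homogeneousComponent p]
  refine Ideal.sum_mem _ fun k _ => ?_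
  obtain ⟨q, hq, hpq⟩ :=
    MvPolynomial.exists_mem_coeff_eq_of_mem_map (Ideal.mem_comap.mp hp) (k + 1)
  convert hJ q hq k using 1
  ext d
  simp only [MvPolynomial.coeff_homogeneousComponent]
  split_ifs with hd
  · simpa using hpq d (by lia)
  · rfl
end

section
/- Let (R, m_R) be a Noetherian local ring, B a standard graded R-algebra which is an integral domain, A = ⊕_{n≥0} A_n a graded R-subalgebra of B, and ν a valuation of the quotient field QF(B) with values in ℝ that dominates the localization of B at its homogeneous maximal ideal (so in particular m_R is contained in the maximal ideal of the valuation ring of ν). For λ ∈ ℝ_{≥0}, set K_λ = {f ∈ QF(B) : ν(f) ≥ λ} and K_λ^+ = {f ∈ QF(B) : ν(f) > λ}. Suppose t ≥ 1, 0 ≠ f ∈ A_i, 0 ≠ g ∈ A_j, and dim_{R/m_R}( (A_i ∩ K_{ν(f)}) / (A_i ∩ K^+_{ν(f)}) ) ≥ t. Then dim_{R/m_R}( (A_{i+j} ∩ K_{ν(fg)}) / (A_{i+j} ∩ K^+_{ν(fg)}) ) ≥ t. -/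
open IsLocalRing

/-- `classDimGE v N t lam` says that the `R/m_R`-vector space
`(N ∩ K_lam) / (N ∩ K⁺_lam)` has dimension at least `t`, where
`K_lam = {x ∈ QF(B) : v x ≥ lam}` and `K⁺_lam = {x ∈ QF(B) : v x > lam}`: this is expressed by
the existence of `t` elements of `N ∩ K_lam` whose classes modulo `K⁺_lam` are linearly
independent over the residue field `R/m_R`. -/
def classDimGE {R B K : Type*} [CommRing R] [IsLocalRing R] [CommRing B] [Algebra R B]
    [Field K] [Algebra B K] [Algebra R K] [IsScalarTower R B K]
    (v : AddValuation K (WithTop ℝ)) (N : Submodule R B) (t : ℕ) (lam : WithTop ℝ) : Prop :=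
  ∃ F : Fin t → B,
    (∀ a, F a ∈ N ∧ lam ≤ v (algebraMap B K (F a))) ∧
    ∀ coef : Fin t → R, lam < v (algebraMap B K (∑ a, coef a • F a)) →
      ∀ a, coef a ∈ IsLocalRing.maximalIdeal R


/-- **Lemma 2.8.**  Let `(R, m_R)` be a Noetherian local ring, `B` a standard graded
`R`-algebra which is a domain, `A = ⊕_{n ≥ 0} A_n` a graded `R`-subalgebra of `B`, and `ν` a
real-valued valuation of `QF(B)` dominating the localization of `B` at its homogeneous maximal
ideal `m_B = m_R B + B_+`.  If `t ≥ 1`, `0 ≠ f ∈ A_i`, `0 ≠ g ∈ A_j` and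
`dim_{R/m_R} (A_i ∩ K_{ν f})/(A_i ∩ K⁺_{ν f}) ≥ t`, then
`dim_{R/m_R} (A_{i+j} ∩ K_{ν (fg)})/(A_{i+j} ∩ K⁺_{ν (fg)}) ≥ t`. -/
theorem epsilon_mult_stmt6
    {R B K : Type*} [CommRing R] [IsLocalRing R] [IsNoetherianRing R]
    [CommRing B] [IsDomain B] [Algebra R B]
    (𝒜 : ℕ → Submodule R B) [GradedAlgebra 𝒜]
    (hstd : ∀ n, 𝒜 n = 𝒜 1 ^ n) (hfg : (𝒜 1).FG)
    (A : ℕ → Submodule R B) (hAle : ∀ n, A n ≤ 𝒜 n) (hA0 : (1 : B) ∈ A 0)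
    (hAmul : ∀ i j, A i * A j ≤ A (i + j))
    [Field K] [Algebra B K] [IsFractionRing B K] [Algebra R K] [IsScalarTower R B K]
    (v : AddValuation K (WithTop ℝ))
    -- `ν` dominates the localization of `B` at its homogeneous maximal ideal:
    (hvB : ∀ b : B, 0 ≤ v (algebraMap B K b))
    (hvdom : ∀ b : B,
      b ∈ (IsLocalRing.maximalIdeal R).map (algebraMap R B) ⊔ Ideal.span (𝒜 1 : Set B) ↔
        0 < v (algebraMap B K b))
    (t : ℕ) (ht : 1 ≤ t) (i j : ℕ) (f g : B)
    (hf : f ∈ A i) (hf0 : f ≠ 0) (hg : g ∈ A j) (hg0 : g ≠ 0)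
    (hdim : classDimGE v (A i) t (v (algebraMap B K f))) :
    classDimGE v (A (i + j)) t (v (algebraMap B K (f * g))) := by
  obtain ⟨F, hF, hind⟩ := hdim
  refine ⟨fun a => F a * g, fun a => ⟨hAmul i j (Submodule.mul_mem_mul (hF a).1 hg), ?_⟩,
    fun coef hlt => hind coef ?_⟩
  · simp only [map_mul (algebraMap B K), AddValuation.map_mul]
    exact add_le_add_left (hF a).2 _
  · have hsum : ∑ a, coef a • (F a * g) = (∑ a, coef a • F a) * g := by
      simp only [Finset.sum_mul, smul_mul_assoc]
    rw [hsum, map_mul (algebraMap B K), map_mul (algebraMap B K), AddValuation.map_mul,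
      AddValuation.map_mul] at hlt
    exact lt_of_add_lt_add_right hlt
end

section
/- Let (R, m_R) be a Noetherian local ring, B a standard graded R-algebra which is an integral domain, A = ⊕_{n≥0} A_n a graded R-subalgebra of B, λ_1,…,λ_d real numbers ≥ 1 that are linearly independent over ℚ, ν a valuation of QF(B) dominating the localization of B at its homogeneous maximal ideal with value group ℤλ_1 + … + ℤλ_d ⊂ ℝ, and β a positive integer. For λ ∈ ℝ_{≥0} set K_λ = {f ∈ QF(B) : ν(f) ≥ λ} and K_λ^+ = {f ∈ QF(B) : ν(f) > λ}, and for t ≥ 1 set Γ^{(t)} = {(n_1,…,n_d,n) ∈ ℕ^{d+1} : dim_{R/m_R}( (A_n ∩ K_{n_1λ_1+…+n_dλ_d}) / (A_n ∩ K^+_{n_1λ_1+…+n_dλ_d}) ) ≥ t and n_1+…+n_d ≤ βn}. If Γ^{(t)} ⊄ {0}, then Γ^{(t)} is a subsemigroup of ℕ^{d+1}, i.e., it is closed under componentwise addition. -/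
open IsLocalRing

/-- The set `Γ^{(t)} ⊆ ℕ^{d+1}` of tuples `(n_1, …, n_d, n)` such that
`dim_{R/m_R} (A_n ∩ K_{n_1 λ_1 + ⋯ + n_d λ_d})/(A_n ∩ K⁺_{n_1 λ_1 + ⋯ + n_d λ_d}) ≥ t` and
`n_1 + ⋯ + n_d ≤ β n`. -/
def gammaSet {R B K : Type*} [CommRing R] [IsLocalRing R] [CommRing B] [Algebra R B]
    [Field K] [Algebra B K] [Algebra R K] [IsScalarTower R B K]
    (v : AddValuation K (WithTop ℝ)) (A : ℕ → Submodule R B) {d : ℕ} (lam : Fin d → ℝ)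
    (β t : ℕ) : Set ((Fin d → ℕ) × ℕ) :=
  {q | classDimGE v (A q.2) t ((∑ i, (q.1 i : ℝ) * lam i : ℝ) : WithTop ℝ) ∧
    ∑ i, q.1 i ≤ β * q.2}

/-- A piece of dimension at least one contains an element of value exactly `lam`. -/
theorem classDimGE.exists_valuation_eq {R B K : Type*} [CommRing R] [IsLocalRing R] [CommRing B]
    [Algebra R B] [Field K] [Algebra B K] [Algebra R K] [IsScalarTower R B K]
    {v : AddValuation K (WithTop ℝ)} {N : Submodule R B} {t : ℕ} {lam : WithTop ℝ}
    (h : classDimGE v N t lam) (ht : 1 ≤ t) : ∃ g ∈ N, v (algebraMap B K g) = lam := by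
  obtain ⟨F, hF, hind⟩ := h
  refine ⟨F ⟨0, ht⟩, (hF _).1, (le_antisymm (hF _).2 (not_lt.1 fun hlt => ?_)).symm⟩
  have h1 := hind (Pi.single ⟨0, ht⟩ 1) (by simpa [Pi.single_apply, ite_smul] using hlt) ⟨0, ht⟩
  rw [Pi.single_eq_same] at h1
  exact (Ideal.ne_top_iff_one _).1 (IsLocalRing.maximalIdeal.isMaximal R).ne_top h1

/-- Multiplication by an element of value `mu` preserves linear independence of classes. -/
theorem classDimGE.mul_right {R B K : Type*} [CommRing R] [IsLocalRing R] [CommRing B]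
    [Algebra R B] [Field K] [Algebra B K] [Algebra R K] [IsScalarTower R B K]
    {v : AddValuation K (WithTop ℝ)} {N P : Submodule R B} {t : ℕ} {lam mu : WithTop ℝ}
    (h : classDimGE v N t lam) {g : B} (hg : v (algebraMap B K g) = mu)
    (hNP : ∀ f ∈ N, f * g ∈ P) : classDimGE v P t (lam + mu) := by
  obtain ⟨F, hF, hind⟩ := h
  refine ⟨fun a => F a * g, fun a => ⟨hNP _ (hF a).1, ?_⟩, fun coef hc => hind coef ?_⟩
  · rw [map_mul, v.map_mul, hg]
    gcongr
    exact (hF a).2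
  · simp_rw [← smul_mul_assoc] at hc
    rw [← Finset.sum_mul, map_mul, v.map_mul, hg] at hc
    exact lt_of_add_lt_add_right hc

/-- **Proposition 2.9 (i).**  Let `(R, m_R)` be a Noetherian local ring, `B` a standard graded
`R`-algebra which is a domain, `A` a graded `R`-subalgebra of `B`, `λ_1, …, λ_d` real numbers
`≥ 1` linearly independent over `ℚ`, and `ν` a valuation of `QF(B)` dominating the
localization of `B` at its homogeneous maximal ideal, with value group
`ℤ λ_1 + ⋯ + ℤ λ_d ⊂ ℝ`.  If `Γ^{(t)} ⊄ {0}`, then `Γ^{(t)}` is a subsemigroup of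
`ℕ^{d+1}`. -/
theorem epsilon_mult_stmt7
    {R B K : Type*} [CommRing R] [IsLocalRing R] [IsNoetherianRing R]
    [CommRing B] [IsDomain B] [Algebra R B]
    (𝒜 : ℕ → Submodule R B) [GradedAlgebra 𝒜]
    (hstd : ∀ n, 𝒜 n = 𝒜 1 ^ n) (hfg : (𝒜 1).FG)
    (A : ℕ → Submodule R B) (hAle : ∀ n, A n ≤ 𝒜 n) (hA0 : (1 : B) ∈ A 0)
    (hAmul : ∀ i j, A i * A j ≤ A (i + j))
    [Field K] [Algebra B K] [IsFractionRing B K] [Algebra R K] [IsScalarTower R B K]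
    (d : ℕ) (lam : Fin d → ℝ) (hlam1 : ∀ i, 1 ≤ lam i) (hlamInd : LinearIndependent ℚ lam)
    (v : AddValuation K (WithTop ℝ))
    -- `ν` dominates the localization of `B` at its homogeneous maximal ideal:
    (hvB : ∀ b : B, 0 ≤ v (algebraMap B K b))
    (hvdom : ∀ b : B,
      b ∈ (IsLocalRing.maximalIdeal R).map (algebraMap R B) ⊔ Ideal.span (𝒜 1 : Set B) ↔
        0 < v (algebraMap B K b))
    -- the value group of `ν` is `ℤ λ_1 + ⋯ + ℤ λ_d ⊂ ℝ`:
    (hval : ∀ x : K, x ≠ 0 → ∃ m : Fin d → ℤ, v x = ((∑ i, (m i : ℝ) * lam i : ℝ) : WithTop ℝ))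
    (hval' : ∀ m : Fin d → ℤ, ∃ x : K, x ≠ 0 ∧ v x = ((∑ i, (m i : ℝ) * lam i : ℝ) : WithTop ℝ))
    (β : ℕ) (hβ : 1 ≤ β) (t : ℕ) (ht : 1 ≤ t)
    (hΓ : ¬ gammaSet v A lam β t ⊆ {0}) :
    ∀ x ∈ gammaSet v A lam β t, ∀ y ∈ gammaSet v A lam β t,
      x + y ∈ gammaSet v A lam β t := by
  rintro x ⟨hx, hxβ⟩ y ⟨hy, hyβ⟩
  obtain ⟨g, hgA, hg⟩ := hy.exists_valuation_eq ht
  refine ⟨?_, ?_⟩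
  · have h := hx.mul_right (P := A (x + y).2) hg
      fun f hf => hAmul _ _ (Submodule.mul_mem_mul hf hgA)
    convert h using 1
    rw [← WithTop.coe_add, ← Finset.sum_add_distrib]
    simp [add_mul]
  · simp only [Prod.fst_add, Prod.snd_add, Pi.add_apply, Finset.sum_add_distrib, mul_add]
    exact add_le_add hxβ hyβ
end

section
/- Suppose R is a universally catenary Noetherian local ring with maximal ideal m_R, B = ⊕_{n≥0} B_n is a reduced standard graded R-algebra, and A = ⊕_{n≥0} A_n is a standard graded R-subalgebra of B. Then dim A ≤ dim B, where dim denotes Krull dimension. -/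
open IsLocalRing

/-- A ring is *catenary* if any two saturated chains of prime ideals with the same endpoints
have the same length. -/
def IsCatenaryRing (S : Type*) [CommRing S] : Prop :=
  ∀ c₁ c₂ : LTSeries (PrimeSpectrum S),
    c₁.head = c₂.head → c₁.last = c₂.last →
    (∀ i : Fin c₁.length, c₁.toFun i.castSucc ⋖ c₁.toFun i.succ) →
    (∀ i : Fin c₂.length, c₂.toFun i.castSucc ⋖ c₂.toFun i.succ) →
    c₁.length = c₂.length

/-- A ring is *universally catenary* if every finitely generated algebra over it
(equivalently, every polynomial algebra over it) is catenary. -/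
def IsUniversallyCatenary (R : Type*) [CommRing R] : Prop :=
  ∀ n : ℕ, IsCatenaryRing (MvPolynomial (Fin n) R)

/-- Inside a domain `D` over a Noetherian ring `R`, a finite set `s` contains an algebraically
independent subset `t` with `dim R[s] ≤ dim R + |t|`. -/
theorem exists_algebraicIndepOn_ringKrullDim_adjoin_le {R D : Type*} [CommRing R]
    [IsNoetherianRing R] [CommRing D] [IsDomain D] [Algebra R D] [FaithfulSMul R D]
    (s : Finset D) :
    ∃ t : Finset D, t ⊆ s ∧ AlgebraicIndepOn R id (t : Set D) ∧
      ringKrullDim (Algebra.adjoin R (s : Set D)) ≤ ringKrullDim R + t.card := by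
  classical
  induction s using Finset.induction_on with
  | empty =>
    refine ⟨∅, subset_rfl, ?_, ?_⟩
    · simpa [AlgebraicIndepOn] using FaithfulSMul.algebraMap_injective R D
    · rw [Finset.card_empty, Nat.cast_zero, add_zero, Finset.coe_empty, Algebra.adjoin_empty]
      refine ringKrullDim_le_of_surjective (algebraMap R (⊥ : Subalgebra R D)) ?_
      rintro ⟨x, hx⟩
      obtain ⟨r, rfl⟩ := Algebra.mem_bot.mp hx
      exact ⟨r, rfl⟩
  | insert x s _ ih =>
    obtain ⟨t, hts, ht, hdim⟩ := ih
    set S := Algebra.adjoin R (s : Set D) with hS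
    have : IsNoetherianRing S :=
      Algebra.FiniteType.isNoetherianRing R S (h := S.fg_iff_finiteType.mp ⟨s, rfl⟩)
    set S' := Algebra.adjoin R ((insert x s : Finset D) : Set D) with hS'
    have hmem (p : Polynomial S) : Polynomial.aeval x p ∈ S' := by
      induction p using Polynomial.induction_on' with
      | add p q hp hq => simpa using add_mem hp hq
      | monomial n a =>
        have h1 : (a : D) ∈ S' :=
          Algebra.adjoin_mono (by simp) a.2
        have h2 : x ∈ S' := Algebra.subset_adjoin (by simp)
        rw [Polynomial.aeval_monomial]
        exact mul_mem h1 (pow_mem h2 n)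
    let f : Polynomial S →+* S' := (Polynomial.aeval x).toRingHom.codRestrict S' hmem
    have hf : Function.Surjective f := by
      have hle : S' ≤ (Polynomial.aeval x : Polynomial S →ₐ[S] D).range.restrictScalars R := by
        rw [hS', Algebra.adjoin_le_iff]
        intro y hy
        simp only [Finset.coe_insert, Set.mem_insert_iff, Finset.mem_coe] at hy
        rcases hy with rfl | hy
        · exact ⟨Polynomial.X, by simp⟩
        · exact ⟨Polynomial.C ⟨y, Algebra.subset_adjoin hy⟩, by simp⟩
      rintro ⟨y, hy⟩
      obtain ⟨p, hp⟩ := hle hy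
      exact ⟨p, Subtype.ext hp⟩
    by_cases hx : IsAlgebraic S x
    · obtain ⟨p, hp0, hp⟩ := hx
      refine ⟨t, hts.trans (Finset.subset_insert _ _), ht, le_trans ?_ hdim⟩
      have := ringKrullDim_succ_le_of_surjective f hf (mem_nonZeroDivisors_of_ne_zero hp0)
        (Subtype.ext hp)
      rw [Polynomial.ringKrullDim_of_isNoetherianRing] at this
      exact ENat.WithBot.add_le_add_one_right_iff.mp this
    · have htx : x ∉ t := fun h ↦ hx (isAlgebraic_algebraMap
        (⟨x, Algebra.subset_adjoin (hts h)⟩ : S))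
      refine ⟨insert x t, Finset.insert_subset_insert _ hts, ?_, ?_⟩
      · rw [Finset.coe_insert]
        refine ht.insert ?_
        have hle : Algebra.adjoin R (id '' (t : Set D)) ≤ S :=
          Algebra.adjoin_mono (by simpa using hts)
        intro h
        exact hx (h.tower_top_of_subalgebra_le hle)
      · rw [Finset.card_insert_of_notMem htx]
        refine (ringKrullDim_le_of_surjective f hf).trans ?_
        rw [Polynomial.ringKrullDim_of_isNoetherianRing]
        push_cast
        rw [← add_assoc]
        gcongr

/-- Every maximal ideal of a polynomial ring in `n` variables over a field has height `n`. -/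
theorem MvPolynomial.height_of_isMaximal {K : Type*} [Field K] (n : ℕ)
    (M : Ideal (MvPolynomial (Fin n) K)) [hM : M.IsMaximal] : M.height = n := by
  induction n with
  | zero =>
    let e := MvPolynomial.isEmptyRingEquiv K (Fin 0)
    have : IsField (MvPolynomial (Fin 0) K) := e.toMulEquiv.isField (Field.toIsField K)
    let := this.toField
    rw [Ideal.eq_bot_of_prime M]
    simp [Ideal.height_bot]
  | succ n ih =>
    let e := (MvPolynomial.finSuccEquiv K n).toRingEquiv
    rw [← RingEquiv.height_map e]
    set P := M.map e with hP
    have : P.IsMaximal := Ideal.map_isMaximal_of_equiv e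
    have hp : (P.under (MvPolynomial (Fin n) K)).IsMaximal :=
      Polynomial.isMaximal_comap_C_of_isJacobsonRing P
    have : P.LiesOver (P.under (MvPolynomial (Fin n) K)) := ⟨rfl⟩
    rw [Polynomial.height_eq_height_add_one (P.under (MvPolynomial (Fin n) K)) P, ih]
    simp

/-- In a finitely generated domain over a field, algebraically independent families are no larger
than the height of any maximal ideal. -/
theorem card_le_height_of_isMaximal {K D : Type*} [Field K] [CommRing D] [IsDomain D]
    [Algebra K D] [Algebra.FiniteType K D] (M : Ideal D) [M.IsMaximal]
    {ι : Type*} [Fintype ι] {x : ι → D} (hx : AlgebraicIndependent K x) :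
    (Fintype.card ι : ℕ∞) ≤ M.height := by
  obtain ⟨s, g, hinj, hint⟩ := exists_integral_inj_algHom_of_fg K D
  algebraize [g.toRingHom]
  have : IsScalarTower K (MvPolynomial (Fin s) K) D := .of_algHom g
  have : FaithfulSMul (MvPolynomial (Fin s) K) D :=
    (faithfulSMul_iff_algebraMap_injective _ _).mpr hinj
  have : Algebra.IsIntegral (MvPolynomial (Fin s) K) D := ⟨hint⟩
  have : IsNoetherianRing D := Algebra.FiniteType.isNoetherianRing K D
  have hmax : (M.under (MvPolynomial (Fin s) K)).IsMaximal :=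
    Ideal.isMaximal_comap_of_isIntegral_of_isMaximal M
  have htr : Algebra.trdeg K D = s := by
    have h := lift_trdeg_add_eq K (MvPolynomial (Fin s) K) D
    have hzero : Algebra.trdeg (MvPolynomial (Fin s) K) D = 0 := trdeg_eq_zero
    simpa [hzero] using h.symm
  have hs : Fintype.card ι ≤ s := by
    have := hx.lift_cardinalMk_le_trdeg
    rw [htr] at this
    simpa using this
  rw [Ideal.height_eq_height_add_of_liesOver_of_hasGoingDown (M.under (MvPolynomial (Fin s) K)) M,
    MvPolynomial.height_of_isMaximal]
  exact le_add_right (by exact_mod_cast hs)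

theorem coheight_eq_ringKrullDim_quotient {A : Type*} [CommRing A] (p : PrimeSpectrum A) :
    (Order.coheight p : WithBot ℕ∞) = ringKrullDim (A ⧸ p.asIdeal) := by
  rw [ringKrullDim_quotient, Order.coheight_eq_krullDim_Ici]
  rfl

theorem height_add_ringKrullDim_quotient_le {A : Type*} [CommRing A] (p : Ideal A)
    [hp : p.IsPrime] : p.height + ringKrullDim (A ⧸ p) ≤ ringKrullDim A := by
  have := coheight_eq_ringKrullDim_quotient ⟨p, hp⟩
  rw [← this, show p.height = _ from PrimeSpectrum.height_eq_orderHeight ⟨p, hp⟩]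
  have : Nonempty (PrimeSpectrum A) := ⟨⟨p, hp⟩⟩
  rw [ringKrullDim, Order.krullDim_eq_iSup_height_add_coheight_of_nonempty]
  exact_mod_cast le_iSup (fun a : PrimeSpectrum A ↦ Order.height a + Order.coheight a) ⟨p, hp⟩

/-- If a finitely generated domain `D` over `R` retracts onto `R`, then an algebraically
independent family `x` satisfies `dim R + |x| ≤ dim D`. -/
theorem ringKrullDim_add_card_le {R D : Type*} [CommRing R] [IsNoetherianRing R]
    [CommRing D] [IsDomain D] [Algebra R D] [Algebra.FiniteType R D] [FaithfulSMul R D]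
    (φ : D →ₐ[R] R) {ι : Type*} [Fintype ι] {x : ι → D} (hx : AlgebraicIndependent R x) :
    ringKrullDim R + Fintype.card ι ≤ ringKrullDim D := by
  have : IsDomain R := (FaithfulSMul.algebraMap_injective R D).isDomain
  let J := RingHom.ker φ
  have hφ : Function.Surjective φ := fun r ↦ ⟨algebraMap R D r, by simp⟩
  have : J.IsPrime := RingHom.ker_isPrime _
  let e : (D ⧸ J) ≃+* R := RingHom.quotientKerEquivOfSurjective (f := φ.toRingHom) hφ
  refine le_trans ?_ (height_add_ringKrullDim_quotient_le J)
  rw [ringKrullDim_eq_of_ringEquiv e, add_comm]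
  gcongr
  let K := FractionRing R
  let DK := Localization (Algebra.algebraMapSubmonoid D (nonZeroDivisors R))
  have hM : Algebra.algebraMapSubmonoid D (nonZeroDivisors R) ≤ nonZeroDivisors D :=
    map_le_nonZeroDivisors_of_injective _ (FaithfulSMul.algebraMap_injective R D) le_rfl
  have : IsDomain DK := IsLocalization.isDomain_localization hM
  have : Algebra.FiniteType K DK :=
    have : Algebra.IsPushout R K D DK :=
      (Algebra.isPushout_of_isLocalization (nonZeroDivisors R) K D DK).symm
    .equiv inferInstance (Algebra.IsPushout.equiv R K D DK)
  have : Algebra.IsAlgebraic R K := IsLocalization.isAlgebraic K (nonZeroDivisors R)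
  let φK : DK →ₐ[K] K := IsLocalization.mapₐ (nonZeroDivisors R) K DK K φ
  have hφK : Function.Surjective φK := fun r ↦ ⟨algebraMap K DK r, by simp⟩
  have : (RingHom.ker φK).IsMaximal := RingHom.ker_isMaximal_of_surjective φK hφK
  have hJ : (RingHom.ker φK).under D = J := by
    ext d
    simp [φK, J, RingHom.mem_ker, IsLocalization.map_eq]
  rw [← hJ, IsLocalization.height_under (Algebra.algebraMapSubmonoid D (nonZeroDivisors R))]
  have hx' : AlgebraicIndependent R (algebraMap D DK ∘ x) :=
    hx.map' (f := IsScalarTower.toAlgHom R D DK) (IsLocalization.injective DK hM)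
  exact_mod_cast card_le_height_of_isMaximal _ (hx'.extendScalars K)

/-- A finitely generated subalgebra of a finitely generated domain `D` over `R` which retracts
onto `R` has dimension at most `dim D`. -/
theorem ringKrullDim_adjoin_le_of_retraction {R D : Type*} [CommRing R] [IsNoetherianRing R]
    [CommRing D] [IsDomain D] [Algebra R D] [Algebra.FiniteType R D] [FaithfulSMul R D]
    (φ : D →ₐ[R] R) (s : Finset D) :
    ringKrullDim (Algebra.adjoin R (s : Set D)) ≤ ringKrullDim D := by
  obtain ⟨t, -, ht, hdim⟩ := exists_algebraicIndepOn_ringKrullDim_adjoin_le (R := R) s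
  refine hdim.trans ?_
  simpa using ringKrullDim_add_card_le φ (ι := t) ht

/-- A standard graded algebra is of finite type. -/
theorem Algebra.FiniteType.of_graded_eq_pow {R B : Type*} [CommRing R] [CommRing B] [Algebra R B]
    (𝒜 : ℕ → Submodule R B) [GradedAlgebra 𝒜] (hstd : ∀ n, 𝒜 n = 𝒜 1 ^ n) (hfg : (𝒜 1).FG) :
    Algebra.FiniteType R B := by
  obtain ⟨s, hs⟩ := hfg
  refine ⟨s, ?_⟩
  have h1 : 𝒜 1 ≤ Subalgebra.toSubmodule (Algebra.adjoin R (s : Set B)) :=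
    hs ▸ Submodule.span_le.mpr Algebra.subset_adjoin
  have hpow (n : ℕ) : 𝒜 1 ^ n ≤ Subalgebra.toSubmodule (Algebra.adjoin R (s : Set B)) := by
    induction n with
    | zero =>
      rw [pow_zero, Submodule.one_le]
      exact one_mem (Algebra.adjoin R (s : Set B))
    | succ n ih =>
      rw [pow_succ, Submodule.mul_le]
      exact fun a ha b hb ↦ mul_mem (S := Subalgebra R B) (ih ha) (h1 hb)
  rw [← Algebra.toSubmodule_eq_top, _root_.eq_top_iff,
    ← (DirectSum.Decomposition.isInternal 𝒜).submodule_iSup_eq_top, iSup_le_iff]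
  exact fun n ↦ hstd n ▸ hpow n

/-- Minimal primes of a graded ring are homogeneous. -/
theorem Ideal.IsHomogeneous.of_mem_minimalPrimes {R B : Type*} [CommRing R] [CommRing B]
    [Algebra R B] (𝒜 : ℕ → Submodule R B) [GradedAlgebra 𝒜] {Q : Ideal B}
    (hQ : Q ∈ minimalPrimes B) : Q.IsHomogeneous 𝒜 := by
  have hprime : (Q.homogeneousCore 𝒜).toIdeal.IsPrime := hQ.1.1.homogeneousCore
  rw [Ideal.IsHomogeneous.iff_eq]
  exact le_antisymm (Q.toIdeal_homogeneousCore_le 𝒜)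
    (hQ.2 ⟨hprime, bot_le⟩ (Q.toIdeal_homogeneousCore_le 𝒜))

/-- Modulo a homogeneous ideal, projection to degree zero is a retraction onto the image of the
base ring. -/
theorem exists_retraction_quotient_of_isHomogeneous {R B : Type*} [CommRing R] [CommRing B]
    [Algebra R B] (𝒜 : ℕ → Submodule R B) [GradedAlgebra 𝒜] (h0 : 𝒜 0 = 1) {Q : Ideal B}
    (hQ : Q.IsHomogeneous 𝒜) :
    Nonempty ((B ⧸ Q) →ₐ[(⊥ : Subalgebra R (B ⧸ Q))] (⊥ : Subalgebra R (B ⧸ Q))) := by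
  let ψ : B ⧸ Q →+* B ⧸ Q := Ideal.Quotient.lift Q
    ((Ideal.Quotient.mk Q).comp (GradedRing.projZeroRingHom 𝒜)) fun b hb ↦
      Ideal.Quotient.eq_zero_iff_mem.mpr (hQ 0 hb)
  have hψ (b : B ⧸ Q) : ψ b ∈ (⊥ : Subalgebra R (B ⧸ Q)) := by
    obtain ⟨b, rfl⟩ := Ideal.Quotient.mk_surjective b
    have hb : GradedRing.projZeroRingHom 𝒜 b ∈ (1 : Submodule R B) :=
      h0 ▸ SetLike.coe_mem (DirectSum.decompose 𝒜 b 0)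
    obtain ⟨r, hr⟩ := Submodule.mem_one.mp hb
    exact Algebra.mem_bot.mpr ⟨r, congrArg (Ideal.Quotient.mk Q) hr⟩
  refine ⟨{ ψ.codRestrict (⊥ : Subalgebra R (B ⧸ Q)) hψ with commutes' := ?_ }⟩
  rintro ⟨x, hx⟩
  obtain ⟨r, rfl⟩ := Algebra.mem_bot.mp hx
  have hr : algebraMap R B r ∈ 𝒜 0 := h0 ▸ Submodule.mem_one.mpr ⟨r, rfl⟩
  exact Subtype.ext (congrArg (Ideal.Quotient.mk Q) (DirectSum.decompose_of_mem_same 𝒜 hr))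

/-- **Lemma 2.15.**  Suppose `R` is a universally catenary Noetherian local ring with maximal
ideal `m_R`, `B = ⊕_{n ≥ 0} B_n` is a reduced standard graded `R`-algebra and
`A = ⊕_{n ≥ 0} A_n` is a standard graded `R`-subalgebra of `B` (so `A_n = E ^ n` for
`E = A_1 ≤ B_1`, and `A = R[E] = Algebra.adjoin R E`).  Then `dim A ≤ dim B`. -/
theorem epsilon_mult_stmt13
    {R B : Type*} [CommRing R] [IsLocalRing R] [IsNoetherianRing R]
    (hcat : IsUniversallyCatenary R)
    [CommRing B] [IsReduced B] [Algebra R B]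
    (𝒜 : ℕ → Submodule R B) [GradedAlgebra 𝒜]
    (hstd : ∀ n, 𝒜 n = 𝒜 1 ^ n) (hfg : (𝒜 1).FG)
    (E : Submodule R B) (hE : E ≤ 𝒜 1) (hEfg : E.FG) :
    ringKrullDim ↥(Algebra.adjoin R (E : Set B)) ≤ ringKrullDim B := by
  classical
  obtain ⟨s, rfl⟩ := hEfg
  rw [Algebra.adjoin_span]
  set A := Algebra.adjoin R (s : Set B)
  rw [ringKrullDim, Order.krullDim_eq_iSup_coheight, iSup_le_iff]
  intro p
  rw [coheight_eq_ringKrullDim_quotient]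
  obtain ⟨P, hP, hPp⟩ := Ideal.exists_minimalPrimes_le (bot_le (a := p.asIdeal))
  have hbot : (⊥ : Ideal B).comap A.val.toRingHom = ⊥ :=
    (RingHom.injective_iff_ker_eq_bot _).mp Subtype.val_injective
  obtain ⟨Q, hQ, hQP⟩ := Ideal.exists_minimalPrimes_comap_eq A.val.toRingHom P (hbot ▸ hP)
  have : Q.IsPrime := hQ.1.1
  let R' : Subalgebra R (B ⧸ Q) := ⊥
  have hR' : Function.Surjective (algebraMap R R') := by
    rintro ⟨x, hx⟩
    obtain ⟨r, rfl⟩ := Algebra.mem_bot.mp hx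
    exact ⟨r, rfl⟩
  have : IsNoetherianRing R' := isNoetherianRing_of_surjective _ _ _ hR'
  have : Algebra.FiniteType R B := .of_graded_eq_pow 𝒜 hstd hfg
  have : Algebra.FiniteType R (B ⧸ Q) :=
    .of_surjective (Ideal.Quotient.mkₐ R Q) Ideal.Quotient.mk_surjective
  have : Algebra.FiniteType R' (B ⧸ Q) := .of_restrictScalars_finiteType R R' (B ⧸ Q)
  obtain ⟨φ⟩ := exists_retraction_quotient_of_isHomogeneous 𝒜 (by rw [hstd, pow_zero])
    (Ideal.IsHomogeneous.of_mem_minimalPrimes 𝒜 hQ)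
  set s' := s.image (Ideal.Quotient.mk Q)
  have hmap : (A.map (Ideal.Quotient.mkₐ R Q) : Set (B ⧸ Q)) =
      Algebra.adjoin R' (s' : Set (B ⧸ Q)) := by
    rw [AlgHom.map_adjoin, Finset.coe_image, ← Subalgebra.coe_restrictScalars R (S := R'),
      Algebra.restrictScalars_adjoin, Algebra.adjoin_union, Algebra.adjoin_eq, bot_sup_eq]
    rfl
  let f : A →+* Algebra.adjoin R' (s' : Set (B ⧸ Q)) :=
    ((Ideal.Quotient.mk Q).comp A.val.toRingHom).codRestrict _ fun a ↦
      hmap.subset ⟨a, a.2, rfl⟩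
  have hf : Function.Surjective f := by
    rintro ⟨x, hx⟩
    obtain ⟨a, ha, rfl⟩ := hmap.superset hx
    exact ⟨⟨a, ha⟩, rfl⟩
  have hker : RingHom.ker f = P := by
    rw [← hQP]
    ext a
    rw [RingHom.mem_ker, Ideal.mem_comap, ← Ideal.Quotient.eq_zero_iff_mem, ← Subtype.coe_inj]
    rfl
  calc ringKrullDim (A ⧸ p.asIdeal)
    _ ≤ ringKrullDim (A ⧸ P) :=
      ringKrullDim_le_of_surjective _ (Ideal.Quotient.factor_surjective hPp)
    _ = ringKrullDim (Algebra.adjoin R' (s' : Set (B ⧸ Q))) := by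
      rw [← hker]
      exact ringKrullDim_eq_of_ringEquiv (RingHom.quotientKerEquivOfSurjective hf)
    _ ≤ ringKrullDim (B ⧸ Q) := ringKrullDim_adjoin_le_of_retraction φ s'
    _ ≤ ringKrullDim B := ringKrullDim_quotient_le Q
end

section
/- Suppose (R, m_R) is a Noetherian local ring, B = ⊕_{n≥0} B_n is a standard graded R-algebra, and A = ⊕_{n≥0} A_n is a standard graded R-subalgebra of B. Then there exists a positive integer c_0 such that for all integers c ≥ c_0 and all n ≥ 1, (m_R^{cn}·B) ∩ A_n = (m_R^{cn}·B_n) ∩ (A_n :_{B_n} m_R^∞), where (A_n :_{B_n} m_R^∞) = {b ∈ B_n : m_R^k·b ⊆ A_n for some k ≥ 0}. -/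
open IsLocalRing

/-- The saturation `{x : M | ∃ k, I ^ k • x ⊆ N}` of a submodule `N` of `M` with respect to an
ideal `I` of `R`. -/
def Submodule.smulSaturation {R M : Type*} [CommRing R] [AddCommGroup M] [Module R M]
    (I : Ideal R) (N : Submodule R M) : Submodule R M where
  carrier := {x | ∃ k : ℕ, ∀ r ∈ I ^ k, r • x ∈ N}
  zero_mem' := ⟨0, fun r _ => by simp⟩
  add_mem' := by
    rintro a b ⟨k, hk⟩ ⟨l, hl⟩
    refine ⟨k + l, fun r hr => ?_⟩
    rw [smul_add]
    exact N.add_mem (hk r (Ideal.pow_le_pow_right (Nat.le_add_right k l) hr))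
      (hl r (Ideal.pow_le_pow_right (Nat.le_add_left l k) hr))
  smul_mem' := by
    rintro c x ⟨k, hk⟩
    exact ⟨k, fun r hr => by rw [smul_comm]; exact N.smul_mem c (hk r hr)⟩

/-- `H⁰_I(M)`, the `I`-torsion submodule `{x : M | ∃ k, I ^ k • x = 0}` of `M`. -/
def Ideal.torsion {R : Type*} [CommRing R] (I : Ideal R) (M : Type*) [AddCommGroup M]
    [Module R M] : Submodule R M :=
  Submodule.smulSaturation I (⊥ : Submodule R M)


/-- If every element of a finitely generated submodule `L` is `I`-power torsion modulo `N`, then a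
single power of `I` carries `L` into `N`. -/
theorem Submodule.exists_pow_smul_le_of_le_smulSaturation {R M : Type*} [CommRing R]
    [AddCommGroup M] [Module R M] (I : Ideal R) (N : Submodule R M) {L : Submodule R M}
    (hL : L.FG) (h : L ≤ Submodule.smulSaturation I N) : ∃ e : ℕ, I ^ e • L ≤ N := by
  induction L, hL using Submodule.fg_induction with
  | singleton x =>
    obtain ⟨k, hk⟩ := h (Submodule.mem_span_singleton_self x)
    refine ⟨k, Submodule.smul_le.2 fun r hr y hy => ?_⟩
    obtain ⟨s, rfl⟩ := Submodule.mem_span_singleton.1 hy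
    rw [smul_comm]
    exact N.smul_mem s (hk r hr)
  | sup L₁ L₂ _ _ ih₁ ih₂ =>
    obtain ⟨e₁, h₁⟩ := ih₁ (le_sup_left.trans h)
    obtain ⟨e₂, h₂⟩ := ih₂ (le_sup_right.trans h)
    refine ⟨e₁ + e₂, ?_⟩
    rw [Submodule.smul_sup]
    exact sup_le
      ((Submodule.smul_mono_left (Ideal.pow_le_pow_right (Nat.le_add_right _ _))).trans h₁)
      ((Submodule.smul_mono_left (Ideal.pow_le_pow_right (Nat.le_add_left _ _))).trans h₂)

/-- An Artin–Rees type bound for the saturation of an ideal. -/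
theorem Ideal.exists_pow_inf_smulSaturation_le {S : Type*} [CommRing S] [IsNoetherianRing S]
    (J N : Ideal S) :
    ∃ C : ℕ, ∀ m, C ≤ m → J ^ m ⊓ Submodule.smulSaturation J N ≤ J ^ (m - C) * N := by
  obtain ⟨e, he⟩ := Submodule.exists_pow_smul_le_of_le_smulSaturation J N
    (IsNoetherian.noetherian (Submodule.smulSaturation J N)) le_rfl
  obtain ⟨k, hk⟩ := J.exists_pow_inf_eq_pow_smul (Submodule.smulSaturation J N)
  refine ⟨k + e, fun m hm => ?_⟩
  have h := hk m (by omega)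
  rw [smul_eq_mul, Ideal.mul_top] at h
  rw [h, show m - k = (m - (k + e)) + e by omega, pow_add, mul_smul]
  exact Submodule.smul_mono le_rfl ((Submodule.smul_mono le_rfl inf_le_right).trans he)

/-- The coefficients of an element of the extension of `K` to the Rees algebra of `I`. -/
theorem reesAlgebra.coeff_mem_mul_pow {B : Type*} [CommRing B] {I K : Ideal B}
    {y : reesAlgebra I} (hy : y ∈ K.map (algebraMap B (reesAlgebra I))) (n : ℕ) :
    (y : Polynomial B).coeff n ∈ K * I ^ n := by
  induction hy using Submodule.span_induction generalizing n with
  | mem y hy =>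
    obtain ⟨a, ha, rfl⟩ := hy
    change (Polynomial.C a).coeff n ∈ _
    rw [Polynomial.coeff_C]
    split_ifs with h
    · simpa [h] using ha
    · exact zero_mem _
  | zero => simp
  | add y z _ _ hy hz => simpa using add_mem (hy n) (hz n)
  | smul s y _ hy =>
    change ((s : Polynomial B) * (y : Polynomial B)).coeff n ∈ _
    rw [Polynomial.coeff_mul]
    refine sum_mem fun p hp => ?_
    rw [← Finset.HasAntidiagonal.mem_antidiagonal.1 hp, pow_add, mul_left_comm]
    exact Ideal.mul_mem_mul (s.2 p.1) (hy p.2)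

theorem reesAlgebra.mem_map_of_coe_eq_monomial {B : Type*} [CommRing B] {I K : Ideal B} {n : ℕ}
    {x : B} (hx : x ∈ K * I ^ n) {y : reesAlgebra I}
    (hy : (y : Polynomial B) = Polynomial.monomial n x) :
    y ∈ K.map (algebraMap B (reesAlgebra I)) := by
  suffices H : ∃ z ∈ K.map (algebraMap B (reesAlgebra I)),
      (z : Polynomial B) = Polynomial.monomial n x by
    obtain ⟨z, hz, hzx⟩ := H
    rwa [Subtype.ext (hy.trans hzx.symm)]
  clear hy y
  induction hx using Submodule.mul_induction_on' with
  | mem_mul_mem a ha b hb =>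
    refine ⟨algebraMap B _ a * ⟨Polynomial.monomial n b, reesAlgebra.monomial_mem.2 hb⟩,
      Ideal.mul_mem_right _ _ (Ideal.mem_map_of_mem _ ha), ?_⟩
    exact Polynomial.C_mul_monomial
  | add a _ b _ ha hb =>
    obtain ⟨y, hy, hya⟩ := ha
    obtain ⟨z, hz, hzb⟩ := hb
    exact ⟨y + z, add_mem hy hz, by simp [hya, hzb]⟩

/-- In a Noetherian ring, `J ^ (c * n) ⊓ (I ^ n : J ^ ∞) ≤ I ^ n` for all large `c`, uniformly
in `n`. -/
theorem Ideal.exists_pow_mul_inf_smulSaturation_pow_le {B : Type*} [CommRing B]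
    [IsNoetherianRing B] (I J : Ideal B) :
    ∃ c₀ : ℕ, 1 ≤ c₀ ∧ ∀ c, c₀ ≤ c → ∀ n,
      J ^ (c * n) ⊓ Submodule.smulSaturation J (I ^ n) ≤ I ^ n := by
  let φ := algebraMap B (reesAlgebra I)
  obtain ⟨C, hC⟩ := Ideal.exists_pow_inf_smulSaturation_le (J.map φ) (I.map φ)
  have step (m : ℕ) (hm : C ≤ m) (i : ℕ) (x : B) (hx : x ∈ J ^ m * I ^ i)
      (hsat : x ∈ Submodule.smulSaturation J (I ^ (i + 1))) :
      x ∈ J ^ (m - C) * I ^ (i + 1) := by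
    have hxi : x ∈ I ^ i := Ideal.mul_le_right hx
    let y : reesAlgebra I := ⟨Polynomial.monomial i x, reesAlgebra.monomial_mem.2 hxi⟩
    obtain ⟨k, hk⟩ := hsat
    have hy : y ∈ Submodule.smulSaturation (J.map φ) (I.map φ) := by
      refine ⟨k, fun r hr => ?_⟩
      rw [← Ideal.map_pow] at hr
      induction hr using Submodule.span_induction with
      | mem r hr =>
        obtain ⟨a, ha, rfl⟩ := hr
        refine reesAlgebra.mem_map_of_coe_eq_monomial (n := i) (x := a * x) ?_
          Polynomial.C_mul_monomial
        rw [← pow_succ']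
        exact hk a ha
      | zero => simp
      | add r s _ _ hr hs => rw [add_smul]; exact add_mem hr hs
      | smul s r _ hr => rw [smul_assoc]; exact Submodule.smul_mem _ _ hr
    have hyJ : y ∈ J.map φ ^ m := by
      rw [← Ideal.map_pow]
      exact reesAlgebra.mem_map_of_coe_eq_monomial hx rfl
    have h := hC m hm ⟨hyJ, hy⟩
    rw [← Ideal.map_pow, ← Ideal.map_mul] at h
    simpa [y, mul_assoc, pow_succ'] using reesAlgebra.coeff_mem_mul_pow h i
  refine ⟨C + 1, by omega, fun c hc n x ⟨hxJ, k, hk⟩ => ?_⟩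
  have key (i : ℕ) (hi : i ≤ n) : x ∈ J ^ (c * n - C * i) * I ^ i := by
    induction i with
    | zero => simpa using hxJ
    | succ i ih =>
      have hle : C * i + C ≤ c * n := by
        calc C * i + C = C * (i + 1) := by ring
          _ ≤ c * n := Nat.mul_le_mul (by omega) hi
      rw [show c * n - C * (i + 1) = c * n - C * i - C by rw [Nat.sub_sub, mul_add_one]]
      exact step _ (by omega) i x (ih (by omega))
        ⟨k, fun r hr => Ideal.pow_le_pow_right hi (hk r hr)⟩
  exact Ideal.mul_le_right (key n le_rfl)

section Graded

variable {R B : Type*} [CommRing R] [CommRing B] [Algebra R B]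

theorem Submodule.pow_le_restrictScalars_span_pow (E : Submodule R B) (n : ℕ) :
    E ^ n ≤ (Ideal.span (E : Set B) ^ n).restrictScalars R := by
  induction n with
  | zero => simp
  | succ n ih =>
    rw [pow_succ, pow_succ, Submodule.mul_le]
    exact fun a ha b hb => Ideal.mul_mem_mul (ih ha) (Ideal.subset_span hb)

theorem Submodule.span_pow_le_span_coe_pow (E : Submodule R B) (n : ℕ) :
    Ideal.span (E : Set B) ^ n ≤ Ideal.span ((E ^ n : Submodule R B) : Set B) := by
  induction n with
  | zero =>
    refine fun x _ => ?_
    rw [(Ideal.eq_top_iff_one _).2 (Ideal.subset_span (by simpa using ⟨1, map_one _⟩))]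
    trivial
  | succ n ih =>
    rw [pow_succ]
    refine (Ideal.mul_mono_left ih).trans ?_
    rw [Ideal.span_mul_span', Ideal.span_le]
    rintro _ ⟨a, ha, b, hb, rfl⟩
    exact Ideal.subset_span (by rw [pow_succ]; exact Submodule.mul_mem_mul ha hb)

variable (𝒜 : ℕ → Submodule R B) [GradedAlgebra 𝒜]

theorem GradedAlgebra.finiteType_of_eq_pow (hstd : ∀ n, 𝒜 n = 𝒜 1 ^ n) (hfg : (𝒜 1).FG) :
    Algebra.FiniteType R B := by
  classical
  obtain ⟨s, hs⟩ := hfg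
  refine ⟨⟨s, ?_⟩⟩
  have h1 : 𝒜 1 ≤ Subalgebra.toSubmodule (Algebra.adjoin R (s : Set B)) := by
    rw [← hs]
    exact Algebra.span_le_adjoin R _
  have hpow (n : ℕ) : 𝒜 n ≤ Subalgebra.toSubmodule (Algebra.adjoin R (s : Set B)) := by
    rw [hstd]
    induction n with
    | zero => rw [pow_zero]; exact Submodule.one_le.2 (Subalgebra.one_mem _)
    | succ n ih =>
      rw [pow_succ, Submodule.mul_le]
      exact fun a ha b hb => Subalgebra.mul_mem _ (ih ha) (h1 hb)
  refine eq_top_iff.2 fun x _ => ?_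
  rw [← DirectSum.sum_support_decompose 𝒜 x]
  refine sum_mem fun n _ => ?_
  exact hpow n (SetLike.coe_mem _)

/-- A homogeneous element of degree `n` in the ideal generated by `F ⊆ 𝒜 n` lies in `F`. -/
theorem GradedAlgebra.mem_of_mem_span_of_mem (h0 : 𝒜 0 = 1) {n : ℕ} {F : Submodule R B}
    (hF : F ≤ 𝒜 n) {x : B} (hx : x ∈ Ideal.span (F : Set B)) (hxn : x ∈ 𝒜 n) : x ∈ F := by
  suffices H : ∀ s : B, (DirectSum.decompose 𝒜 (s * x) n : B) ∈ F by
    have h := H 1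
    rwa [one_mul, DirectSum.decompose_of_mem_same 𝒜 hxn] at h
  clear hxn
  induction hx using Submodule.span_induction with
  | mem y hy =>
    intro s
    rw [DirectSum.coe_decompose_mul_of_right_mem_of_le 𝒜 (hF hy) le_rfl, Nat.sub_self]
    have hs : (DirectSum.decompose 𝒜 s 0 : B) ∈ (1 : Submodule R B) := h0 ▸ SetLike.coe_mem _
    obtain ⟨r, hr⟩ := Submodule.mem_one.1 hs
    rw [← hr, ← Algebra.smul_def]
    exact F.smul_mem r hy
  | zero => simp
  | add y z _ _ hy hz => simpa [mul_add] using fun s => add_mem (hy s) (hz s)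
  | smul a y _ hy =>
    intro s
    rw [smul_eq_mul, ← mul_assoc]
    exact hy (s * a)

theorem GradedAlgebra.mem_smul_of_mem_map_of_mem (K : Ideal R) {n : ℕ} {x : B}
    (hx : x ∈ K.map (algebraMap R B)) (hxn : x ∈ 𝒜 n) : x ∈ K • 𝒜 n := by
  have h : x ∈ K • (⊤ : Submodule R B) := by
    rwa [Ideal.smul_top_eq_map]
  rw [← DirectSum.decompose_of_mem_same 𝒜 hxn]
  clear hxn hx
  induction h using Submodule.smul_induction_on' with
  | smul r hr b _ =>
    rw [DirectSum.decompose_smul]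
    exact Submodule.smul_mem_smul hr (SetLike.coe_mem _)
  | add y _ z _ hy hz => simpa using add_mem hy hz

end Graded

/-- A step in **Theorem 2.16**.  Suppose `(R, m_R)` is a Noetherian local ring,
`B = ⊕_{n ≥ 0} B_n` is a standard graded `R`-algebra and `A = ⊕_{n ≥ 0} A_n` is a standard
graded `R`-subalgebra of `B` (so `A_n = E ^ n` for `E = A_1 ≤ B_1`).  Then there is a positive
integer `c_0` such that for all `c ≥ c_0` and all `n ≥ 1`,
`(m_R^{cn} B) ∩ A_n = (m_R^{cn} B_n) ∩ (A_n :_{B_n} m_R^∞)`, where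
`(A_n :_{B_n} m_R^∞) = {b ∈ B_n : m_R^k b ⊆ A_n for some k ≥ 0}`. -/
theorem epsilon_mult_stmt14
    {R B : Type*} [CommRing R] [IsLocalRing R] [IsNoetherianRing R]
    [CommRing B] [Algebra R B]
    (𝒜 : ℕ → Submodule R B) [GradedAlgebra 𝒜]
    (hstd : ∀ n, 𝒜 n = 𝒜 1 ^ n) (hfg : (𝒜 1).FG)
    (E : Submodule R B) (hE : E ≤ 𝒜 1) (hEfg : E.FG) :
    ∃ c₀ : ℕ, 1 ≤ c₀ ∧ ∀ c : ℕ, c₀ ≤ c → ∀ n : ℕ, 1 ≤ n →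
      Submodule.restrictScalars R
          (Ideal.map (algebraMap R B) (IsLocalRing.maximalIdeal R ^ (c * n))) ⊓ E ^ n =
        ((IsLocalRing.maximalIdeal R ^ (c * n)) • 𝒜 n) ⊓
          (𝒜 n ⊓ Submodule.smulSaturation (IsLocalRing.maximalIdeal R) (E ^ n)) := by
  have hBft : Algebra.FiniteType R B := GradedAlgebra.finiteType_of_eq_pow 𝒜 hstd hfg
  have hB : IsNoetherianRing B := Algebra.FiniteType.isNoetherianRing R B
  have hEn (n : ℕ) : E ^ n ≤ 𝒜 n := hstd n ▸ pow_le_pow_left' hE n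
  obtain ⟨c₀, hc₀, H⟩ := Ideal.exists_pow_mul_inf_smulSaturation_pow_le
    (Ideal.span (E : Set B)) ((maximalIdeal R).map (algebraMap R B))
  refine ⟨c₀, hc₀, fun c hc n _ => le_antisymm ?_ ?_⟩
  · rintro x ⟨hxm, hxE⟩
    exact ⟨GradedAlgebra.mem_smul_of_mem_map_of_mem 𝒜 _ hxm (hEn n hxE), hEn n hxE,
      0, fun r _ => Submodule.smul_mem _ r hxE⟩
  · rintro x ⟨hxm, hxn, k, hk⟩
    have hxJ : x ∈ (maximalIdeal R ^ (c * n)).map (algebraMap R B) := by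
      have h := Submodule.smul_mono (le_refl (maximalIdeal R ^ (c * n))) (le_top : 𝒜 n ≤ ⊤) hxm
      rwa [Ideal.smul_top_eq_map] at h
    refine ⟨hxJ, ?_⟩
    have hsat : x ∈ Submodule.smulSaturation ((maximalIdeal R).map (algebraMap R B))
        (Ideal.span (E : Set B) ^ n) := by
      refine ⟨k, fun r hr => ?_⟩
      rw [← Ideal.map_pow] at hr
      induction hr using Submodule.span_induction with
      | mem r hr =>
        obtain ⟨a, ha, rfl⟩ := hr
        rw [algebraMap_smul]
        exact E.pow_le_restrictScalars_span_pow n (hk a ha)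
      | zero => simp
      | add r s _ _ hr hs => rw [add_smul]; exact add_mem hr hs
      | smul s r _ hr => rw [smul_assoc]; exact Submodule.smul_mem _ _ hr
    rw [Ideal.map_pow] at hxJ
    exact GradedAlgebra.mem_of_mem_span_of_mem 𝒜 (by rw [hstd 0, pow_zero]) (hEn n)
      (E.span_pow_le_span_coe_pow n (H c hc n ⟨hxJ, hsat⟩)) hxn
end
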